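/- arXiv:1802.05754 — 2 statements merged into one kernel-verified Lean document; each statement's English description precedes it below -/
import Mathlib

section
/- Let $(E,\Sigma,m)$ be a $\sigma$-finite measure space, let $c : \mathbb{R}^\ell \times \mathbb{R}^\ell \to \mathbb{R}$ be continuous and bounded from below, and let $\lambda \mapsto (\mu_\lambda, \nu_\lambda)$ be a measurable map from $E$ into pairs of Borel probability measures on $\mathbb{R}^\ell$. Assume that for $m$-almost every $\lambda$ there exists a unique Borel measurable map $F_\lambda : \mathbb{R}^\ell \to \mathbb{R}^\ell$ such that the pushforward of $\mu_\lambda$ by $F_\lambda$ equals $\nu_\lambda$ and the graph of $F_\lambda$ is $c$-cyclically monotone. Then there exists a jointly measurable function $F : E \times \mathbb{R}^\ell \to \mathbb{R}^\ell$ such that for $m$-almost every $\lambda$ one has $F(\lambda, y) = F_\lambda(y)$ for $\mu_\lambda$-almost every $y$. -/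
open MeasureTheory

/-- A set `Γ ⊆ α × α` is `c`-cyclically monotone if for every finite cyclic family of points
of `Γ` one has `∑ c(xᵢ, yᵢ) ≤ ∑ c(xᵢ, yᵢ₊₁)` (indices mod the length of the family). -/
def CCyclicallyMonotone {α : Type*} (c : α → α → ℝ) (Γ : Set (α × α)) : Prop :=
  ∀ (N : ℕ) (p : Fin (N + 1) → α × α), (∀ i, p i ∈ Γ) →
    ∑ i, c (p i).1 (p i).2 ≤ ∑ i, c (p i).1 (p (i + 1)).2

section SelAux
open Set Filter Topology ProbabilityTheory
open scoped ENNReal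

theorem aux_cap (g : (ℕ → ℕ) → ℝ) (hg : Continuous g) (m : Measure ℝ) [IsFiniteMeasure m]
    (r : ℝ≥0∞) (hr : r < m (range g)) : ∃ K : Set (ℕ → ℕ), IsCompact K ∧ r ≤ m (g '' K) := by
  have step : ∀ (n : ℕ) (C : {C : Set (ℕ → ℕ) // r < m (g '' C)}),
      ∃ j : ℕ, r < m (g '' (C.1 ∩ {s | s n ≤ j})) := by
    rintro n ⟨C, hC⟩
    have hU : g '' C = ⋃ j : ℕ, g '' (C ∩ {s | s n ≤ j}) := by
      rw [← image_iUnion, ← inter_iUnion]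
      congr 1
      ext s
      simp only [mem_inter_iff, mem_iUnion, mem_ofPred_eq]
      exact ⟨fun h => ⟨h, s n, le_rfl⟩, fun h => h.1⟩
    have hmono : Monotone fun j : ℕ => g '' (C ∩ {s | s n ≤ j}) := by
      intro a b hab
      exact image_mono (inter_subset_inter_right _ fun s hs => le_trans hs hab)
    rw [hU, hmono.measure_iUnion] at hC
    exact lt_iSup_iff.1 hC
  choose j hj using step
  let D : ℕ → {C : Set (ℕ → ℕ) // r < m (g '' C)} := fun n =>
    Nat.rec ⟨univ, by simpa using hr⟩ (fun n C => ⟨_, hj n C⟩) n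
  let k : ℕ → ℕ := fun n => j n (D n)
  have hDs : ∀ n, (D (n + 1)).1 = (D n).1 ∩ {s | s n ≤ k n} := fun n => rfl
  have hD : ∀ n, (D n).1 = {s | ∀ i < n, s i ≤ k i} := by
    intro n
    induction n with
    | zero => simp [D]
    | succ n ih =>
      rw [hDs, ih]
      ext s
      simp only [mem_inter_iff, mem_ofPred_eq, Nat.lt_succ_iff_lt_or_eq]
      constructor
      · rintro ⟨h1, h2⟩ i (h | rfl)
        exacts [h1 i h, h2]
      · intro h
        exact ⟨fun i hi => h i (Or.inl hi), h n (Or.inr rfl)⟩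
  let K : Set (ℕ → ℕ) := Set.pi univ fun i => Iic (k i)
  have hK : IsCompact K := isCompact_univ_pi fun i => (finite_Iic (k i)).isCompact
  refine ⟨K, hK, ?_⟩
  have hsub : (⋂ n, closure (g '' (D n).1)) ⊆ g '' K := by
    intro e he
    have : ∀ n : ℕ, ∃ s ∈ (D n).1, dist (g s) e < 1 / ((n : ℝ) + 1) := by
      intro n
      have h1 := mem_iInter.1 he n
      obtain ⟨b, ⟨s, hs, rfl⟩, hb⟩ := Metric.mem_closure_iff.1 h1 (1 / ((n : ℝ) + 1)) (by positivity)
      exact ⟨s, hs, by rwa [dist_comm]⟩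
    choose s hsD hsd using this
    obtain ⟨a, haK, φ, hφ, hlim⟩ := hK.tendsto_subseq (x := fun n i => min (s n i) (k i))
      (fun n i _ => mem_Iic.2 (min_le_right _ _))
    refine ⟨a, haK, ?_⟩
    have hs' : Tendsto (fun n => s (φ n)) atTop (𝓝 a) := by
      rw [tendsto_pi_nhds] at hlim ⊢
      intro i
      refine (hlim i).congr' ?_
      filter_upwards [eventually_gt_atTop i] with n hn
      have h2 := hsD (φ n)
      rw [hD] at h2
      exact min_eq_left (h2 i (lt_of_lt_of_le hn (hφ.id_le n)))
    have h3 : Tendsto (fun n => g (s (φ n))) atTop (𝓝 (g a)) := (hg.tendsto a).comp hs'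
    have h4 : Tendsto (fun n => g (s n)) atTop (𝓝 e) := by
      rw [tendsto_iff_dist_tendsto_zero]
      exact squeeze_zero (fun _ => dist_nonneg) (fun n => (hsd n).le)
        tendsto_one_div_add_atTop_nhds_zero_nat
    exact tendsto_nhds_unique h3 (h4.comp hφ.tendsto_atTop)
  refine le_trans ?_ (measure_mono hsub)
  have hanti : Antitone fun n => closure (g '' (D n).1) := by
    refine antitone_nat_of_succ_le fun n => closure_mono (image_mono ?_)
    rw [hDs]
    exact inter_subset_left
  have ht := tendsto_measure_iInter_atTop (μ := m)
    (fun n => (isClosed_closure (s := g '' (D n).1)).measurableSet.nullMeasurableSet) hanti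
    ⟨0, measure_ne_top _ _⟩
  exact ge_of_tendsto' ht fun n => (D n).2.le.trans (measure_mono subset_closure)

theorem aux_sec (C : Set (ℝ × ℝ)) (hC : IsCompact C) :
    ∃ s : ℝ → ℝ, Measurable s ∧ ∀ e ∈ Prod.fst '' C, (e, s e) ∈ C := by
  have hcs : ∀ e, IsCompact {y | (e, y) ∈ C} := by
    intro e
    have : {y | (e, y) ∈ C} = Prod.snd '' (C ∩ {p | p.1 = e}) := by
      ext y
      constructor
      · intro h
        exact ⟨(e, y), ⟨h, rfl⟩, rfl⟩
      · rintro ⟨⟨a, b⟩, ⟨h, h1⟩, rfl⟩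
        simp only [mem_ofPred_eq] at h1
        subst h1
        exact h
    rw [this]
    exact (hC.inter_right (isClosed_eq continuous_fst continuous_const)).image continuous_snd
  have hmem : ∀ e ∈ Prod.fst '' C, (e, sInf {y | (e, y) ∈ C}) ∈ C := by
    rintro _ ⟨⟨a, b⟩, h, rfl⟩
    exact (hcs a).sInf_mem ⟨b, h⟩
  refine ⟨fun e => sInf {y | (e, y) ∈ C}, ?_, hmem⟩
  have hP : MeasurableSet (Prod.fst '' C) := (hC.image continuous_fst).measurableSet
  refine measurable_of_Iic fun q => ?_
  have : (fun e => sInf {y | (e, y) ∈ C}) ⁻¹' Iic q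
      = Prod.fst '' (C ∩ {p | p.2 ≤ q}) ∪ ((Prod.fst '' C)ᶜ ∩ {_e | 0 ≤ q}) := by
    ext e
    by_cases he : e ∈ Prod.fst '' C
    · constructor
      · intro h
        exact Or.inl ⟨_, ⟨hmem e he, h⟩, rfl⟩
      · rintro (⟨⟨a, b⟩, ⟨h1, h2⟩, rfl⟩ | h)
        · exact (csInf_le (hcs a).bddBelow h1).trans h2
        · exact absurd he h.1
    · have h0 : {y | (e, y) ∈ C} = ∅ := by
        ext y
        simp only [mem_ofPred_eq, mem_empty_iff_false, iff_false]
        exact fun h => he ⟨_, h, rfl⟩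
      simp only [mem_preimage, h0, Real.sInf_empty, mem_Iic]
      constructor
      · intro h
        exact Or.inr ⟨he, h⟩
      · rintro (⟨⟨a, b⟩, ⟨h1, h2⟩, rfl⟩ | h)
        · exact absurd ⟨_, h1, rfl⟩ he
        · exact h.2
  rw [this]
  refine MeasurableSet.union ?_ (hP.compl.inter (MeasurableSet.const _))
  exact ((hC.inter_right (isClosed_le continuous_snd continuous_const)).image
    continuous_fst).measurableSet

theorem aux_sel_real (m : Measure ℝ) [IsFiniteMeasure m] (R : Set (ℝ × ℝ)) (hR : MeasurableSet R)
    (hfull : m (Prod.fst '' R) = m univ) :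
    ∃ s : ℝ → ℝ, Measurable s ∧ ∀ᵐ e ∂m, (e, s e) ∈ R := by
  by_cases hm : m univ = 0
  · refine ⟨fun _ => 0, measurable_const, ?_⟩
    rw [Measure.measure_univ_eq_zero.1 hm]
    simp
  have hA := hR.analyticSet
  rw [AnalyticSet] at hA
  rcases hA with rfl | ⟨g, hg, rfl⟩
  · simp only [image_empty, measure_empty] at hfull
    exact absurd hfull.symm hm
  have h1 : ∀ n : ℕ, ∃ C : Set (ℝ × ℝ), IsCompact C ∧ C ⊆ range g ∧
      m univ - ((n : ℝ≥0∞) + 1)⁻¹ ≤ m (Prod.fst '' C) := by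
    intro n
    obtain ⟨K, hK, hKm⟩ := aux_cap (fun s => (g s).1) (continuous_fst.comp hg) m
      (m univ - ((n : ℝ≥0∞) + 1)⁻¹) (by
        rw [show (range fun s => (g s).1) = Prod.fst '' range g from range_comp _ _, hfull]
        exact ENNReal.sub_lt_self (measure_ne_top _ _) hm (by simp))
    refine ⟨g '' K, hK.image hg, image_subset_range _ _, ?_⟩
    rwa [image_image]
  choose C hC hCR hCm using h1
  choose s hs hsC using fun n => aux_sec (C n) (hC n)
  have hP : ∀ n, MeasurableSet (Prod.fst '' C n) := fun n =>
    ((hC n).image continuous_fst).measurableSet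
  let U : Set ℝ := ⋃ n, Prod.fst '' C n
  have hU : MeasurableSet U := MeasurableSet.iUnion hP
  have hUm : m Uᶜ = 0 := by
    rw [measure_compl hU (measure_ne_top _ _), tsub_eq_zero_iff_le]
    have hle : ∀ n : ℕ, m univ ≤ m U + ((n : ℝ≥0∞) + 1)⁻¹ := fun n =>
      tsub_le_iff_right.1 ((hCm n).trans (measure_mono (subset_iUnion (fun n => Prod.fst '' C n) n)))
    refine ge_of_tendsto' (x := atTop) (f := fun n : ℕ => m U + ((n : ℝ≥0∞) + 1)⁻¹) ?_ hle
    have h2 : Tendsto (fun n : ℕ => ((n : ℝ≥0∞) + 1)⁻¹) atTop (𝓝 0) := by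
      have := (tendsto_add_atTop_iff_nat 1).2 ENNReal.tendsto_inv_nat_nhds_zero
      simpa using this
    simpa using tendsto_const_nhds.add h2
  classical
  have hex : ∀ x : ℝ, ∃ n : ℕ, x ∈ Prod.fst '' C n ∨ x ∉ U := by
    intro x
    by_cases hx : x ∈ U
    · obtain ⟨n, hn⟩ := mem_iUnion.1 hx
      exact ⟨n, Or.inl hn⟩
    · exact ⟨0, Or.inr hx⟩
  refine ⟨fun x => s (Nat.find (hex x)) x, ?_, ?_⟩
  · exact Measurable.find (p := fun n x => x ∈ Prod.fst '' C n ∨ x ∉ U) hs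
      (fun n => (hP n).union hU.compl) hex
  · filter_upwards [compl_mem_ae_iff.2 hUm] with x hx
    rw [compl_compl] at hx
    rcases Nat.find_spec (hex x) with h | h
    · exact hCR _ (hsC _ _ h)
    · exact absurd hx h

theorem aux_factor {E : Type*} [MeasurableSpace E] (R : Set (E × ℝ)) (hR : MeasurableSet R) :
    ∃ h : E → ℝ, Measurable h ∧ ∃ R' : Set (ℝ × ℝ), MeasurableSet R' ∧
      ∀ p : E × ℝ, p ∈ R ↔ (h p.1, p.2) ∈ R' := by
  rw [← generateFrom_prod] at hR
  induction R, hR using MeasurableSpace.generateFrom_induction with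
  | hC t ht _ =>
    obtain ⟨a, ha, b, hb, rfl⟩ := ht
    refine ⟨a.indicator 1, measurable_one.indicator ha, {1} ×ˢ b,
      (measurableSet_singleton _).prod hb, ?_⟩
    rintro ⟨e, y⟩
    by_cases h : e ∈ a <;> simp [h]
  | empty => exact ⟨fun _ => 0, measurable_const, ∅, MeasurableSet.empty, by simp⟩
  | compl t _ ih =>
    obtain ⟨h, hh, R', hR', H⟩ := ih
    exact ⟨h, hh, R'ᶜ, hR'.compl, fun p => not_congr (H p)⟩
  | iUnion t _ ih =>
    choose h hh R' hR' H using ih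
    obtain ⟨θ, hθ⟩ := exists_measurableEmbedding_real (ℕ → ℝ)
    obtain ⟨ρ, hρ, hρθ⟩ := hθ.exists_measurable_extend (measurable_id) (fun _ => inferInstance)
    refine ⟨fun e => θ fun n => h n e, hθ.measurable.comp (measurable_pi_lambda _ hh),
      ⋃ n, {p | (ρ p.1 n, p.2) ∈ R' n}, MeasurableSet.iUnion fun n => ?_, ?_⟩
    · exact (((measurable_pi_apply n).comp (hρ.comp measurable_fst)).prodMk measurable_snd) (hR' n)
    · intro p
      have h2 : ρ (θ fun n => h n p.1) = fun n => h n p.1 := congrFun hρθ _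
      simp only [mem_iUnion, mem_ofPred_eq, h2, H]

theorem aux_sel {E D : Type*} [MeasurableSpace E] [MeasurableSpace D] [StandardBorelSpace D]
    [Nonempty D] (m : Measure E) [SigmaFinite m] (R : Set (E × D)) (hR : MeasurableSet R)
    (hfull : ∀ᵐ e ∂m, ∃ d, (e, d) ∈ R) :
    ∃ s : E → D, Measurable s ∧ ∀ᵐ e ∂m, (e, s e) ∈ R := by
  obtain ⟨θ, hθ⟩ := exists_measurableEmbedding_real D
  obtain ⟨ρ, hρ, hρθ⟩ := hθ.exists_measurable_extend (measurable_id) (fun _ => inferInstance)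
  let R1 : Set (E × ℝ) := {p | (p.1, ρ p.2) ∈ R}
  have hR1 : MeasurableSet R1 := (measurable_fst.prodMk (hρ.comp measurable_snd)) hR
  obtain ⟨h, hh, R', hR', H⟩ := aux_factor R1 hR1
  have hfull' : ∀ᵐ e ∂m.toFinite, h e ∈ Prod.fst '' R' := by
    rw [ae_toFinite]
    filter_upwards [hfull] with e ⟨d, hd⟩
    refine ⟨(h e, θ d), ?_, rfl⟩
    refine (H (e, θ d)).1 ?_
    have : ρ (θ d) = d := congrFun hρθ d
    simpa [R1, this] using hd
  obtain ⟨s, hs, hsR⟩ := aux_sel_real (m.toFinite.map h) R' hR' (by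
    rw [← measure_toMeasurable (Prod.fst '' R'), Measure.map_apply hh (measurableSet_toMeasurable _ _),
      Measure.map_apply hh MeasurableSet.univ, preimage_univ]
    refine le_antisymm (measure_mono (subset_univ _)) (measure_mono_ae ?_)
    filter_upwards [hfull'] with e he _
    exact subset_toMeasurable _ _ he)
  refine ⟨fun e => ρ (s (h e)), hρ.comp (hs.comp hh), ?_⟩
  have := ae_of_ae_map hh.aemeasurable hsR
  rw [ae_toFinite] at this
  filter_upwards [this] with e he
  exact (H (e, s (h e))).2 he
end SelAux

section CoreAux
open Set Filter Topology ProbabilityTheory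
open scoped ENNReal

theorem aux_cyc_closure {V : Type*} [TopologicalSpace V] (c : V → V → ℝ)
    (hc : Continuous fun p : V × V => c p.1 p.2) (Γ : Set (V × V))
    (h : CCyclicallyMonotone c Γ) : CCyclicallyMonotone c (closure Γ) := by
  intro N p hp
  have hcl : IsClosed {p : Fin (N + 1) → V × V |
      ∑ i, c (p i).1 (p i).2 ≤ ∑ i, c (p i).1 (p (i + 1)).2} := by
    refine isClosed_le ?_ ?_
    · refine continuous_finsetSum _ fun i _ => ?_
      exact hc.comp (continuous_apply i)
    · refine continuous_finsetSum _ fun i _ => ?_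
      have h1 : Continuous fun p : Fin (N + 1) → V × V => ((p i).1, (p (i + 1)).2) := by fun_prop
      exact hc.comp h1
  have hp' : p ∈ closure (Set.pi univ fun _ : Fin (N + 1) => Γ) := by
    rw [closure_pi_set]
    exact fun i _ => hp i
  exact closure_minimal (fun q hq => h N q fun i => Set.mem_univ_pi.1 hq i) hcl hp'

theorem aux_pot {V : Type*} [TopologicalSpace V] [MeasurableSpace V] [BorelSpace V]
    (c : V → V → ℝ)
    (hc : Continuous fun p : V × V => c p.1 p.2) (Γ : Set (V × V))
    (h : CCyclicallyMonotone c Γ) (z0 : V × V) (hz0 : z0 ∈ Γ) :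
    ∃ ψ : V → EReal, Measurable ψ ∧ (∀ y, ψ y ≠ ⊤) ∧ (∀ z ∈ Γ, ψ z.2 ≠ ⊥) ∧
      ∀ z ∈ Γ, ∀ y, ψ y ≤ ψ z.2 + ((c z.1 y - c z.1 z.2 : ℝ) : EReal) := by
  let val : ℕ → (ℕ → V × V) → V → ℝ := fun n z y =>
    ∑ i ∈ Finset.range n, (c (z i).1 (z (i + 1)).2 - c (z i).1 (z i).2)
      + (c (z n).1 y - c (z n).1 (z n).2)
  let I := ℕ × {z : ℕ → V × V // (∀ i, z i ∈ Γ) ∧ z 0 = z0}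
  let ψ : V → EReal := fun y => ⨅ i : I, (val i.1 i.2.1 y : EReal)
  have hle : ∀ (n : ℕ) (z : ℕ → V × V) (y : V), (∀ i, z i ∈ Γ) → z 0 = z0 →
      ψ y ≤ (val n z y : EReal) := fun n z y h1 h2 =>
    iInf_le (fun i : I => (val i.1 i.2.1 y : EReal)) (n, ⟨z, h1, h2⟩)
  have hstar : ∀ z ∈ Γ, ∀ y, ψ y ≤ ψ z.2 + ((c z.1 y - c z.1 z.2 : ℝ) : EReal) := by
    intro z hz y
    rw [← EReal.sub_le_iff_le_add (Or.inl (EReal.coe_ne_bot _)) (Or.inl (EReal.coe_ne_top _))]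
    refine le_iInf ?_
    rintro ⟨n, w, hw, hw0⟩
    rw [EReal.sub_le_iff_le_add (Or.inl (EReal.coe_ne_bot _)) (Or.inl (EReal.coe_ne_top _)),
      ← EReal.coe_add]
    refine (hle (n + 1) (fun i => if i ≤ n then w i else z) y ?_ ?_).trans (le_of_eq ?_)
    · intro i
      split_ifs
      exacts [hw i, hz]
    · simpa using hw0
    · congr 1
      simp only [val]
      rw [Finset.sum_range_succ]
      have h1 : ∀ i ∈ Finset.range n,
          (c (if i ≤ n then w i else z).1 (if i + 1 ≤ n then w (i + 1) else z).2
            - c (if i ≤ n then w i else z).1 (if i ≤ n then w i else z).2)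
          = c (w i).1 (w (i + 1)).2 - c (w i).1 (w i).2 := by
        intro i hi
        have hi' := Finset.mem_range.1 hi
        rw [if_pos (by omega), if_pos (by omega)]
      rw [Finset.sum_congr rfl h1]
      simp
  have h0 : 0 ≤ ψ z0.2 := by
    refine le_iInf ?_
    rintro ⟨n, w, hw, hw0⟩
    have := h n (fun i => w i) (fun i => hw i)
    rw [Fin.sum_univ_castSucc, Fin.sum_univ_castSucc] at this
    simp only [Fin.val_castSucc, Fin.val_last, Fin.last_add_one,
      Fin.coeSucc_eq_succ, Fin.val_succ, Fin.val_zero, hw0] at this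
    rw [Fin.sum_univ_eq_sum_range (fun i => c (w i).1 (w i).2) n,
      Fin.sum_univ_eq_sum_range (fun i => c (w i).1 (w (i + 1)).2) n] at this
    have h2 : 0 ≤ val n w z0.2 := by
      simp only [val, Finset.sum_sub_distrib]
      linarith
    exact_mod_cast h2
  refine ⟨ψ, ?_, ?_, ?_, hstar⟩
  · refine UpperSemicontinuous.measurable (upperSemicontinuous_iInf fun i => ?_)
    refine Continuous.upperSemicontinuous (continuous_coe_real_ereal.comp ?_)
    refine continuous_const.add (Continuous.sub ?_ continuous_const)
    exact hc.comp (continuous_const.prodMk continuous_id)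
  · intro y hy
    have := hle 0 (fun _ => z0) y (fun _ => hz0) rfl
    rw [hy] at this
    exact EReal.coe_ne_top _ (top_le_iff.1 this)
  · intro z hz hbot
    have := h0.trans (hstar z hz z0.2)
    rw [hbot, EReal.bot_add] at this
    exact absurd this (by simp)

theorem aux_cyc_of_pot {V : Type*} (c : V → V → ℝ) (ψ : V → ℝ) (B : Set V) (Γ : Set (V × V))
    (h : ∀ z ∈ Γ, z.2 ∈ B ∧ ∀ y ∈ B, ψ y ≤ ψ z.2 + (c z.1 y - c z.1 z.2)) :
    CCyclicallyMonotone c Γ := by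
  intro N p hp
  have h1 : ∑ i, ψ (p (i + 1)).2
      ≤ ∑ i, (ψ (p i).2 + (c (p i).1 (p (i + 1)).2 - c (p i).1 (p i).2)) :=
    Finset.sum_le_sum fun i _ => (h _ (hp i)).2 _ (h _ (hp (i + 1))).1
  have h2 : ∑ i, ψ (p (i + 1)).2 = ∑ i, ψ (p i).2 :=
    Equiv.sum_comp (Equiv.addRight (1 : Fin (N + 1))) fun i => ψ (p i).2
  rw [h2, Finset.sum_add_distrib, Finset.sum_sub_distrib] at h1
  linarith

theorem aux_law {V : Type*} [MeasurableSpace V] (μ : Measure V) [IsProbabilityMeasure μ]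
    (F F' : V → V) (hF : Measurable F) (hF' : Measurable F') (hFF : μ.map F' = μ.map F)
    (w : V → ℝ) (hw : Measurable w) (hle : ∀ᵐ x ∂μ, w (F' x) ≤ w (F x)) :
    ∀ᵐ x ∂μ, w (F' x) = w (F x) := by
  let a : V → ℝ≥0∞ := fun y => ENNReal.ofReal (Real.arctan (w y) + 2)
  have ha : Measurable a := (Measurable.add_const (Real.measurable_arctan.comp hw) 2).ennreal_ofReal
  have hpos : ∀ t, 0 < Real.arctan t + 2 := fun t => by
    have := Real.neg_pi_div_two_lt_arctan t
    have := Real.pi_lt_four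
    linarith
  have key : (fun x => a (F' x)) =ᵐ[μ] fun x => a (F x) := by
    refine ae_eq_of_ae_le_of_lintegral_le ?_ ?_ (ha.comp hF).aemeasurable ?_
    · filter_upwards [hle] with x hx
      exact ENNReal.ofReal_le_ofReal (by
        have := Real.arctan_mono hx
        linarith)
    · refine ne_of_lt (lt_of_le_of_lt (lintegral_mono (g := fun _ => ENNReal.ofReal 4) ?_) ?_)
      · intro x
        refine ENNReal.ofReal_le_ofReal ?_
        have := Real.arctan_lt_pi_div_two (w (F' x))
        have := Real.pi_lt_four
        linarith
      · simp
    · rw [← lintegral_map ha hF, ← lintegral_map ha hF', hFF]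
  filter_upwards [key] with x hx
  have := (ENNReal.ofReal_eq_ofReal_iff (hpos _).le (hpos _).le).1 hx
  exact Real.arctan_injective (by linarith)

theorem aux_core {V : Type*} [TopologicalSpace V] [MeasurableSpace V] [BorelSpace V]
    (c : V → V → ℝ)
    (hc : Continuous fun p : V × V => c p.1 p.2) (μ ν : Measure V) [IsProbabilityMeasure μ]
    (F : V → V) (hF : Measurable F) (hFν : μ.map F = ν)
    (hFc : CCyclicallyMonotone c (Set.range fun y => (y, F y)))
    (huniq : ∀ F'' : V → V, Measurable F'' ∧ μ.map F'' = ν ∧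
      CCyclicallyMonotone c (Set.range fun y => (y, F'' y)) → F'' = F)
    (F' : V → V) (hF' : Measurable F') (hF'ν : μ.map F' = ν)
    (Γ : Set (V × V)) (hΓ : CCyclicallyMonotone c Γ) (hF'Γ : ∀ᵐ x ∂μ, (x, F' x) ∈ Γ) :
    ∀ᵐ x ∂μ, F' x = F x := by
  obtain ⟨x0, hx0⟩ := hF'Γ.exists
  obtain ⟨ψ, hψ, hψt, hψb, hψs⟩ := aux_pot c hc _ hFc (x0, F x0) ⟨x0, rfl⟩
  obtain ⟨ψ', hψ', hψt', hψb', hψs'⟩ := aux_pot c hc Γ hΓ _ hx0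
  have hmF : ∀ x, (x, F x) ∈ Set.range fun y => (y, F y) := fun x => ⟨x, rfl⟩
  have hb1 : ∀ᵐ x ∂μ, ψ (F' x) ≠ ⊥ := by
    have h1 : ∀ᵐ y ∂(μ.map F), ψ y ≠ ⊥ :=
      (ae_map_iff hF.aemeasurable (hψ (measurableSet_singleton ⊥).compl)).2
        (ae_of_all _ fun x => hψb _ (hmF x))
    rw [hFν, ← hF'ν] at h1
    exact ae_of_ae_map hF'.aemeasurable h1
  have hb2 : ∀ᵐ x ∂μ, ψ' (F x) ≠ ⊥ := by
    have h1 : ∀ᵐ y ∂(μ.map F'), ψ' y ≠ ⊥ :=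
      (ae_map_iff hF'.aemeasurable (hψ' (measurableSet_singleton ⊥).compl)).2
        (hF'Γ.mono fun x hx => hψb' _ hx)
    rw [hF'ν, ← hFν] at h1
    exact ae_of_ae_map hF.aemeasurable h1
  have hcoe : ∀ y, ψ y ≠ ⊥ → ((ψ y).toReal : EReal) = ψ y := fun y hy =>
    EReal.coe_toReal (hψt y) hy
  have hcoe' : ∀ y, ψ' y ≠ ⊥ → ((ψ' y).toReal : EReal) = ψ' y := fun y hy =>
    EReal.coe_toReal (hψt' y) hy
  have hR : ∀ x y, ψ y ≠ ⊥ → (ψ y).toReal ≤ (ψ (F x)).toReal + (c x y - c x (F x)) := by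
    intro x y hy
    have := hψs _ (hmF x) y
    rw [← hcoe y hy, ← hcoe _ (hψb _ (hmF x))] at this
    exact_mod_cast this
  have hR' : ∀ x, (x, F' x) ∈ Γ → ∀ y, ψ' y ≠ ⊥ →
      (ψ' y).toReal ≤ (ψ' (F' x)).toReal + (c x y - c x (F' x)) := by
    intro x hx y hy
    have := hψs' _ hx y
    rw [← hcoe' y hy, ← hcoe' _ (hψb' _ hx)] at this
    exact_mod_cast this
  have heq := aux_law μ F F' hF hF' (hF'ν.trans hFν.symm)
    (fun y => (ψ y).toReal - (ψ' y).toReal) (hψ.ereal_toReal.sub hψ'.ereal_toReal) (by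
      filter_upwards [hF'Γ, hb1, hb2] with x h1 h2 h3
      have h4 := hR x (F' x) h2
      have h5 := hR' x h1 (F x) h3
      linarith)
  let B : Set V := {y | ψ y ≠ ⊥}
  let G : Set (V × V) := {z | z.2 ∈ B ∧ ∀ y ∈ B,
    (ψ y).toReal ≤ (ψ z.2).toReal + (c z.1 y - c z.1 z.2)}
  have hG : CCyclicallyMonotone c G := aux_cyc_of_pot c (fun y => (ψ y).toReal) B G fun z hz => hz
  have hF'G : ∀ᵐ x ∂μ, (x, F' x) ∈ G := by
    filter_upwards [hF'Γ, hb1, hb2, heq] with x h1 h2 h3 h6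
    have h5 := hR' x h1 (F x) h3
    refine ⟨h2, fun y hy => ?_⟩
    have h7 := hR x y hy
    dsimp only
    linarith
  have hFG : ∀ x, (x, F x) ∈ G := fun x => ⟨hψb _ (hmF x), fun y hy => hR x y hy⟩
  obtain ⟨T, hTs, hTm, hT0⟩ := exists_measurable_superset_of_null (ae_iff.1 hF'G)
  classical
  let F'' : V → V := T.piecewise F F'
  have hF''ae : F'' =ᵐ[μ] F' := by
    filter_upwards [compl_mem_ae_iff.2 hT0] with x hx
    exact Set.piecewise_eq_of_notMem _ _ _ hx
  have h8 : F'' = F := by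
    refine huniq F'' ⟨hF.piecewise hTm hF', (Measure.map_congr hF''ae).trans hF'ν, ?_⟩
    intro N p hp
    refine hG N p fun i => ?_
    obtain ⟨x, hx⟩ := hp i
    rw [← hx]
    by_cases hxT : x ∈ T
    · simp only [F'', Set.piecewise_eq_of_mem _ _ _ hxT]
      exact hFG x
    · simp only [F'', Set.piecewise_eq_of_notMem _ _ _ hxT]
      by_contra hcon
      exact hxT (hTs hcon)
  rw [h8] at hF''ae
  exact hF''ae.symm
end CoreAux

section ParamAux
open Set Filter Topology ProbabilityTheory
open scoped ENNReal

theorem aux_param_set (ℓ : ℕ) : ∃ H : Set ((ℕ → ℕ → Bool) × (Fin ℓ → ℝ)), MeasurableSet H ∧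
    ∀ (μ : Measure (Fin ℓ → ℝ)) [IsProbabilityMeasure μ] (S : Set (Fin ℓ → ℝ)), MeasurableSet S →
      ∃ d, ∀ᵐ x ∂μ, (d, x) ∈ H ↔ x ∈ S := by
  have hbasis := TopologicalSpace.isBasis_countableBasis (Fin ℓ → ℝ)
  have hne : (TopologicalSpace.countableBasis (Fin ℓ → ℝ)).Nonempty := by
    obtain ⟨v, hv, _⟩ := hbasis.exists_subset_of_mem_open (mem_univ (0 : Fin ℓ → ℝ)) isOpen_univ
    exact ⟨v, hv⟩
  obtain ⟨B, hB⟩ :=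
    (TopologicalSpace.countable_countableBasis (Fin ℓ → ℝ)).exists_eq_range hne
  have hBo : ∀ k, IsOpen (B k) := fun k =>
    hbasis.isOpen (by rw [hB]; exact mem_range_self k)
  refine ⟨⋂ n : ℕ, ⋃ k : ℕ, {p | p.1 n k = true ∧ p.2 ∈ B k}, ?_, ?_⟩
  · refine MeasurableSet.iInter fun n => MeasurableSet.iUnion fun k => MeasurableSet.inter ?_ ?_
    · have : Measurable fun p : (ℕ → ℕ → Bool) × (Fin ℓ → ℝ) => p.1 n k := by fun_prop
      exact this (measurableSet_singleton true)
    · exact measurable_snd (hBo k).measurableSet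
  · intro μ _ S hS
    have h1 : ∀ n : ℕ, ∃ U, S ⊆ U ∧ IsOpen U ∧ μ U < μ S + ((n : ℝ≥0∞) + 1)⁻¹ := fun n =>
      S.exists_isOpen_lt_add (measure_ne_top _ _) (by simp)
    choose U hSU hUo hUm using h1
    classical
    refine ⟨fun n k => decide (B k ⊆ U n), ?_⟩
    have hmem : ∀ x, ((fun n k => decide (B k ⊆ U n), x) ∈
        ⋂ n : ℕ, ⋃ k : ℕ, {p : (ℕ → ℕ → Bool) × (Fin ℓ → ℝ) | p.1 n k = true ∧ p.2 ∈ B k})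
        ↔ x ∈ ⋂ n, U n := by
      intro x
      simp only [mem_iInter, mem_iUnion, mem_ofPred_eq, decide_eq_true_eq]
      refine forall_congr' fun n => ⟨fun ⟨k, h1, h2⟩ => h1 h2, fun h => ?_⟩
      obtain ⟨v, hv, hxv, hvU⟩ := hbasis.exists_subset_of_mem_open h (hUo n)
      rw [hB] at hv
      obtain ⟨k, rfl⟩ := hv
      exact ⟨k, hvU, hxv⟩
    have hsub : S ⊆ ⋂ n, U n := subset_iInter hSU
    have hle : μ (⋂ n, U n) ≤ μ S := by
      have h2 : Tendsto (fun n : ℕ => ((n : ℝ≥0∞) + 1)⁻¹) atTop (𝓝 0) := by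
        have := (tendsto_add_atTop_iff_nat 1).2 ENNReal.tendsto_inv_nat_nhds_zero
        simpa using this
      refine ge_of_tendsto' (x := atTop) (f := fun n : ℕ => μ S + ((n : ℝ≥0∞) + 1)⁻¹)
        (by simpa using tendsto_const_nhds.add h2) fun n => ?_
      exact (measure_mono (iInter_subset _ n)).trans (hUm n).le
    have hae : S =ᵐ[μ] (⋂ n, U n : Set (Fin ℓ → ℝ)) :=
      ae_eq_of_subset_of_measure_ge hsub hle hS.nullMeasurableSet (measure_ne_top _ _)
    filter_upwards [hae.mem_iff] with x hx
    rw [hmem, hx]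

theorem aux_param (ℓ : ℕ) : ∃ G : (ℕ → ℕ → ℕ → Bool) × (Fin ℓ → ℝ) → (Fin ℓ → ℝ), Measurable G ∧
    ∀ (μ : Measure (Fin ℓ → ℝ)) [IsProbabilityMeasure μ] (F : (Fin ℓ → ℝ) → (Fin ℓ → ℝ)),
      Measurable F → ∃ d, ∀ᵐ x ∂μ, G (d, x) = F x := by
  obtain ⟨H, hH, hHs⟩ := aux_param_set ℓ
  obtain ⟨i, him, hii⟩ :=
    MeasurableSpace.measurable_injection_nat_bool_of_countablySeparated (Fin ℓ → ℝ)
  obtain ⟨e, he, hei⟩ := (him.measurableEmbedding hii).exists_measurable_extend measurable_id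
    (fun _ => inferInstance)
  classical
  refine ⟨fun p => e fun j => decide ((p.1 j, p.2) ∈ H), he.comp (measurable_pi_lambda _ fun j => ?_),
    ?_⟩
  · refine measurable_to_bool ?_
    have h1 : Measurable fun p : (ℕ → ℕ → ℕ → Bool) × (Fin ℓ → ℝ) => (p.1 j, p.2) := by fun_prop
    convert h1 hH using 1
    ext p
    simp
  · intro μ _ F hF
    have h1 : ∀ j, ∃ d, ∀ᵐ x ∂μ, (d, x) ∈ H ↔ x ∈ {x | i (F x) j = true} := fun j =>
      hHs μ _ (((measurable_pi_apply j).comp (him.comp hF)) (measurableSet_singleton true))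
    choose d hd using h1
    refine ⟨d, ?_⟩
    filter_upwards [ae_all_iff.2 hd] with x hx
    have h2 : (fun j => decide ((d j, x) ∈ H)) = i (F x) := by
      funext j
      rw [Bool.eq_iff_iff, decide_eq_true_eq, hx j]
    simp only [h2]
    exact congrFun hei (F x)

theorem aux_meas_kernel {E D V : Type*} [MeasurableSpace E] [MeasurableSpace D] [MeasurableSpace V]
    (μ : E → Measure V) (hμ : Measurable μ) (hp : ∀ e, IsProbabilityMeasure (μ e))
    (t : Set ((E × D) × V)) (ht : MeasurableSet t) :
    Measurable fun q : E × D => μ q.1 {x | (q, x) ∈ t} := by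
  let κ : Kernel (E × D) V := ⟨fun q => μ q.1, hμ.comp measurable_fst⟩
  have : IsMarkovKernel κ := ⟨fun q => hp q.1⟩
  exact Kernel.measurable_kernel_prodMk_left (κ := κ) ht

theorem aux_meas_map {E D V : Type*} [MeasurableSpace E] [MeasurableSpace D] [MeasurableSpace V]
    [MeasurableSpace.CountablyGenerated V]
    (μ ν : E → Measure V) (hμ : Measurable μ) (hν : Measurable ν)
    (hp : ∀ e, IsProbabilityMeasure (μ e)) (hpν : ∀ e, IsProbabilityMeasure (ν e))
    (G : D × V → V) (hG : Measurable G) :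
    MeasurableSet {q : E × D | (μ q.1).map (fun x => G (q.2, x)) = ν q.1} := by
  let A := generateSetAlgebra (MeasurableSpace.countableGeneratingSet V)
  have hA : A.Countable := countable_generateSetAlgebra MeasurableSpace.countable_countableGeneratingSet
  have hgen : ‹MeasurableSpace V› = MeasurableSpace.generateFrom A := by
    rw [generateFrom_generateSetAlgebra_eq, MeasurableSpace.generateFrom_countableGeneratingSet]
  have hAm : ∀ s ∈ A, MeasurableSet s := by
    intro s hs
    rw [hgen]
    exact MeasurableSpace.measurableSet_generateFrom hs
  have hGd : ∀ d, Measurable fun x => G (d, x) := fun d => hG.comp measurable_prodMk_left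
  have : {q : E × D | (μ q.1).map (fun x => G (q.2, x)) = ν q.1}
      = ⋂ s ∈ A, {q : E × D | μ q.1 {x | G (q.2, x) ∈ s} = ν q.1 s} := by
    ext q
    simp only [mem_iInter, mem_ofPred_eq]
    constructor
    · intro h s hs
      rw [← h, Measure.map_apply (hGd _) (hAm s hs)]
      rfl
    · intro h
      have := hp q.1
      have := hpν q.1
      refine ext_of_generate_finite A hgen
        (fun s hs t ht _ => isSetAlgebra_generateSetAlgebra.inter_mem hs ht) ?_ ?_
      · intro s hs
        rw [Measure.map_apply (hGd _) (hAm s hs)]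
        exact h s hs
      · rw [Measure.map_apply (hGd _) MeasurableSet.univ]
        simp
  rw [this]
  refine MeasurableSet.biInter hA fun s hs => ?_
  refine measurableSet_eq_fun ?_ ?_
  · have h1 : Measurable fun p : (E × D) × V => G (p.1.2, p.2) :=
      hG.comp (by fun_prop)
    exact aux_meas_kernel μ hμ hp {p : (E × D) × V | G (p.1.2, p.2) ∈ s} (h1 (hAm s hs))
  · exact (Measure.measurable_coe (hAm s hs)).comp (hν.comp measurable_fst)

theorem aux_meas_cyc (ℓ : ℕ) (c : (Fin ℓ → ℝ) → (Fin ℓ → ℝ) → ℝ)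
    (hc : Continuous fun p : (Fin ℓ → ℝ) × (Fin ℓ → ℝ) => c p.1 p.2) :
    MeasurableSet {q : ℕ → (Fin ℓ → ℝ) × (Fin ℓ → ℝ) | CCyclicallyMonotone c (range q)} := by
  have : {q : ℕ → (Fin ℓ → ℝ) × (Fin ℓ → ℝ) | CCyclicallyMonotone c (range q)}
      = ⋂ (N : ℕ), ⋂ (a : Fin (N + 1) → ℕ), {q | ∑ i, c (q (a i)).1 (q (a i)).2
        ≤ ∑ i, c (q (a i)).1 (q (a (i + 1))).2} := by
    ext q
    simp only [mem_iInter, mem_ofPred_eq]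
    constructor
    · intro h N a
      exact h N (fun i => q (a i)) fun i => mem_range_self _
    · intro h N p hp
      choose a ha using hp
      have := h N a
      simpa only [ha] using this
  rw [this]
  refine MeasurableSet.iInter fun N => MeasurableSet.iInter fun a => ?_
  have hm : ∀ i j, Measurable fun q : ℕ → (Fin ℓ → ℝ) × (Fin ℓ → ℝ) => c (q i).1 (q j).2 := by
    intro i j
    have h1 : Measurable fun q : ℕ → (Fin ℓ → ℝ) × (Fin ℓ → ℝ) => ((q i).1, (q j).2) := by
      fun_prop
    exact hc.measurable.comp h1
  exact measurableSet_le (Finset.measurable_sum _ fun i _ => hm _ _)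
    (Finset.measurable_sum _ fun i _ => hm _ _)
end ParamAux

/-- Measurable selection of the (unique) `c`-cyclically monotone
pushforwarding maps: if `(E, m)` is σ-finite, `c : ℝ^ℓ × ℝ^ℓ → ℝ` is continuous and bounded
below, `λ ↦ (μ_λ, ν_λ)` is measurable into pairs of Borel probability measures on `ℝ^ℓ`, and
for `m`-a.e. `λ` there is a unique Borel map `F_λ` pushing `μ_λ` to `ν_λ` whose graph is
`c`-cyclically monotone, then there is a jointly measurable `F : E × ℝ^ℓ → ℝ^ℓ` with
`F (λ, y) = F_λ y` for `μ_λ`-a.e. `y`, for `m`-a.e. `λ`. -/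
theorem stmt_1 (ℓ : ℕ) (E : Type*) [MeasurableSpace E] (m : Measure E) [SigmaFinite m]
    (c : (Fin ℓ → ℝ) → (Fin ℓ → ℝ) → ℝ)
    (hc : Continuous fun p : (Fin ℓ → ℝ) × (Fin ℓ → ℝ) => c p.1 p.2)
    (hcbdd : BddBelow (Set.range fun p : (Fin ℓ → ℝ) × (Fin ℓ → ℝ) => c p.1 p.2))
    (μ ν : E → Measure (Fin ℓ → ℝ))
    (hμν : Measurable fun lam => (μ lam, ν lam))
    (hμprob : ∀ lam, IsProbabilityMeasure (μ lam))
    (hνprob : ∀ lam, IsProbabilityMeasure (ν lam))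
    (huniq : ∀ᵐ lam ∂m, ∃! F : (Fin ℓ → ℝ) → (Fin ℓ → ℝ),
      Measurable F ∧ (μ lam).map F = ν lam ∧
        CCyclicallyMonotone c (Set.range fun y => (y, F y))) :
    ∃ F : E × (Fin ℓ → ℝ) → (Fin ℓ → ℝ), Measurable F ∧
      ∀ᵐ lam ∂m, ∀ Flam : (Fin ℓ → ℝ) → (Fin ℓ → ℝ),
        (Measurable Flam ∧ (μ lam).map Flam = ν lam ∧
          CCyclicallyMonotone c (Set.range fun y => (y, Flam y))) →
        ∀ᵐ y ∂(μ lam), F (lam, y) = Flam y := by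
  obtain ⟨G, hG, hGs⟩ := aux_param ℓ
  have hμ : Measurable μ := measurable_fst.comp hμν
  have hν : Measurable ν := measurable_snd.comp hμν
  let R1 : Set (E × ((ℕ → ℕ → ℕ → Bool) × (ℕ → (Fin ℓ → ℝ) × (Fin ℓ → ℝ)))) := {q | (μ q.1).map (fun x => G (q.2.1, x)) = ν q.1}
  let R2 : Set (E × ((ℕ → ℕ → ℕ → Bool) × (ℕ → (Fin ℓ → ℝ) × (Fin ℓ → ℝ)))) := {q | CCyclicallyMonotone c (Set.range q.2.2)}
  let t : Set ((E × ((ℕ → ℕ → ℕ → Bool) × (ℕ → (Fin ℓ → ℝ) × (Fin ℓ → ℝ)))) × (Fin ℓ → ℝ)) :=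
    {p | (p.2, G (p.1.2.1, p.2)) ∈ closure (Set.range p.1.2.2)}
  let R3 : Set (E × ((ℕ → ℕ → ℕ → Bool) × (ℕ → (Fin ℓ → ℝ) × (Fin ℓ → ℝ)))) := {q | μ q.1 {x | (q, x) ∈ tᶜ} = 0}
  have hR1 : MeasurableSet R1 :=
    aux_meas_map μ ν hμ hν hμprob hνprob (fun p : ((ℕ → ℕ → ℕ → Bool) × (ℕ → (Fin ℓ → ℝ) × (Fin ℓ → ℝ))) × (Fin ℓ → ℝ) => G (p.1.1, p.2))
      (hG.comp (by fun_prop))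
  have hR2 : MeasurableSet R2 := (measurable_snd.comp measurable_snd) (aux_meas_cyc ℓ c hc)
  have ht : MeasurableSet t := by
    have h1 : t = ⋂ k : ℕ, ⋃ n : ℕ, {p : (E × ((ℕ → ℕ → ℕ → Bool) × (ℕ → (Fin ℓ → ℝ) × (Fin ℓ → ℝ)))) × (Fin ℓ → ℝ) |
        dist (p.2, G (p.1.2.1, p.2)) (p.1.2.2 n) < 1 / ((k : ℝ) + 1)} := by
      ext p
      simp only [t, Set.mem_iInter, Set.mem_iUnion, Set.mem_ofPred_eq, Metric.mem_closure_iff,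
        Set.exists_range_iff]
      constructor
      · intro h k
        exact h _ (by positivity)
      · intro h ε hε
        obtain ⟨k, hk⟩ := exists_nat_one_div_lt hε
        obtain ⟨n, hn⟩ := h k
        exact ⟨n, hn.trans hk⟩
    rw [h1]
    refine MeasurableSet.iInter fun k => MeasurableSet.iUnion fun n => ?_
    have h2 : Measurable fun p : (E × ((ℕ → ℕ → ℕ → Bool) × (ℕ → (Fin ℓ → ℝ) × (Fin ℓ → ℝ)))) × (Fin ℓ → ℝ) => G (p.1.2.1, p.2) :=
      hG.comp (by fun_prop)
    have h3 : Measurable fun p : (E × ((ℕ → ℕ → ℕ → Bool) × (ℕ → (Fin ℓ → ℝ) × (Fin ℓ → ℝ)))) × (Fin ℓ → ℝ) => p.1.2.2 n := by fun_prop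
    exact measurableSet_lt ((measurable_snd.prodMk h2).dist h3) measurable_const
  have hR3 : MeasurableSet R3 :=
    measurableSet_eq_fun (aux_meas_kernel μ hμ hμprob tᶜ ht.compl) measurable_const
  have i1 : StandardBorelSpace (ℕ → Bool) := inferInstance
  have i2 : StandardBorelSpace (ℕ → ℕ → Bool) := inferInstance
  have i3 : StandardBorelSpace (ℕ → ℕ → ℕ → Bool) := inferInstance
  have i4 : StandardBorelSpace (Fin ℓ → ℝ) := inferInstance
  have i5 : StandardBorelSpace ((Fin ℓ → ℝ) × (Fin ℓ → ℝ)) := inferInstance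
  have i6 : StandardBorelSpace (ℕ → (Fin ℓ → ℝ) × (Fin ℓ → ℝ)) := inferInstance
  obtain ⟨s, hs, hsR⟩ := aux_sel m (R1 ∩ R2 ∩ R3) ((hR1.inter hR2).inter hR3) (by
    filter_upwards [huniq] with e ⟨F, ⟨hF, hFν, hFc⟩, _⟩
    have := hμprob e
    obtain ⟨d, hd⟩ := hGs (μ e) F hF
    have : Nonempty (Set.range fun y => (y, F y)) := ⟨⟨(0, F 0), 0, rfl⟩⟩
    let q := fun n => (TopologicalSpace.denseSeq (Set.range fun y => (y, F y)) n).1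
    have hq : Set.range q ⊆ Set.range fun y => (y, F y) := by
      rintro _ ⟨n, rfl⟩
      exact (TopologicalSpace.denseSeq (Set.range fun y => (y, F y)) n).2
    have hqd : ∀ x, (x, F x) ∈ closure (Set.range q) := by
      intro x
      have h1 := TopologicalSpace.denseRange_denseSeq (Set.range fun y => (y, F y))
        ⟨(x, F x), x, rfl⟩
      have h2 := image_closure_subset_closure_image continuous_subtype_val
        (Set.mem_image_of_mem Subtype.val h1)
      rwa [← Set.range_comp] at h2
    refine ⟨(d, q), ⟨?_, ?_⟩, ?_⟩
    · exact (Measure.map_congr hd).trans hFν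
    · exact fun N p hp => hFc N p fun i => hq (hp i)
    · change ∀ᵐ x ∂(μ e), ((e, (d, q)), x) ∈ t
      filter_upwards [hd] with x hx
      change (x, G (d, x)) ∈ closure (Set.range q)
      rw [hx]
      exact hqd x)
  refine ⟨fun p => G ((s p.1).1, p.2), hG.comp
    ((measurable_fst.comp (hs.comp measurable_fst)).prodMk measurable_snd), ?_⟩
  filter_upwards [huniq, hsR] with e ⟨F0, _, hu⟩ ⟨⟨h1, h2⟩, h3⟩ Flam hFlam
  have := hμprob e
  have h3' : ∀ᵐ x ∂(μ e), ((e, s e), x) ∈ t := h3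
  have hFl := hu Flam hFlam
  exact aux_core c hc (μ e) (ν e) Flam hFlam.1 hFlam.2.1 hFlam.2.2
    (fun F'' h => (hu F'' h).trans hFl.symm) (fun x => G ((s e).1, x))
    (hG.comp measurable_prodMk_left) h1 _ (aux_cyc_closure c hc _ h2) h3'
end

section
/- Let $f : \mathcal{P}(\mathbb{R}^N) \to \mathbb{R}$ be bounded from below, lower semicontinuous with respect to weak convergence of probability measures, and convex in law. Let $(\Omega, \mathcal{F}, \mathbb{P})$ be a probability space, $a < b$ real numbers, and $X : [a,b] \times \Omega \to \mathbb{R}^N$ jointly measurable with $\int_\Omega \int_a^b |X_t(\omega)|\, dt\, \mathbb{P}(d\omega) < \infty$. Then $f\Bigl(\mathcal{L}\Bigl(\frac{1}{b-a}\int_a^b X_t\, dt\Bigr)\Bigr) \le \frac{1}{b-a}\int_a^b f(\mathcal{L}(X_t))\, dt$, where the right-hand side integral is well defined in $(-\infty, +\infty]$. -/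
open MeasureTheory

/-- A function `f` on probability measures on `ℝ^N` is *convex in law* if for every
probability space, every pair of integrable `ℝ^N`-valued random variables `Z, W` and every
`l ∈ [0,1]`, one has `f (ℒ(l Z + (1-l) W)) ≤ l f (ℒ Z) + (1-l) f (ℒ W)`. -/
def ConvexInLaw (N : ℕ) (f : ProbabilityMeasure (Fin N → ℝ) → ℝ) : Prop :=
  ∀ (Ω : Type) (_ : MeasurableSpace Ω) (P : Measure Ω), IsProbabilityMeasure P →
    ∀ (Z W : Ω → (Fin N → ℝ)), Integrable Z P → Integrable W P →
    ∀ l ∈ Set.Icc (0 : ℝ) 1,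
    ∀ (ρZ ρW ρS : ProbabilityMeasure (Fin N → ℝ)),
      (ρZ : Measure (Fin N → ℝ)) = P.map Z →
      (ρW : Measure (Fin N → ℝ)) = P.map W →
      (ρS : Measure (Fin N → ℝ)) = P.map (fun ω => l • Z ω + (1 - l) • W ω) →
      f ρS ≤ l * f ρZ + (1 - l) * f ρW

open Filter Topology ProbabilityTheory in
/-- Strong law of large numbers along i.i.d. samples on the infinite product space. -/
lemma slln_sample {E : Type*} [NormedAddCommGroup E] [NormedSpace ℝ E] [CompleteSpace E]
    [MeasurableSpace E] [BorelSpace E]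
    (μ : Measure ℝ) [IsProbabilityMeasure μ] (h : ℝ → E) (hh : Integrable h μ) :
    ∀ᵐ τ ∂(Measure.infinitePi (fun _ : ℕ => μ)),
      Tendsto (fun n : ℕ => (n : ℝ)⁻¹ • ∑ i ∈ Finset.range n, h (τ i)) atTop (𝓝 (∫ t, h t ∂μ)) := by
  set Q := Measure.infinitePi (fun _ : ℕ => μ)
  have mp : ∀ i : ℕ, MeasurePreserving (fun τ : ℕ → ℝ => τ i) Q μ :=
    fun i => measurePreserving_eval_infinitePi _ i
  set k := hh.aestronglyMeasurable.mk h with hk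
  have hkm : StronglyMeasurable k := hh.aestronglyMeasurable.stronglyMeasurable_mk
  have hke : h =ᵐ[μ] k := hh.aestronglyMeasurable.ae_eq_mk
  have hki : Integrable k μ := hh.congr hke
  have key := strong_law_ae (μ := Q) (fun (i : ℕ) (τ : ℕ → ℝ) => k (τ i))
    ((mp 0).integrable_comp_of_integrable hki)
    (fun i j hij => (iIndepFun_infinitePi (P := fun _ : ℕ => μ) (X := fun _ : ℕ => k)
      (fun _ => hkm.measurable)).indepFun hij)
    (fun i => ⟨(hkm.measurable.comp (measurable_pi_apply i)).aemeasurable,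
      (hkm.measurable.comp (measurable_pi_apply 0)).aemeasurable, by
        have : ∀ i : ℕ, Measure.map (fun τ : ℕ → ℝ => k (τ i)) Q = Measure.map k μ := by
          intro i
          rw [← (mp i).map_eq, Measure.map_map hkm.measurable (mp i).measurable]
          rfl
        rw [this, this]⟩)
  have hall : ∀ᵐ τ ∂Q, ∀ i, h (τ i) = k (τ i) :=
    ae_all_iff.2 fun i => (mp i).quasiMeasurePreserving.ae hke
  have hint : ∫ τ, k (τ 0) ∂Q = ∫ t, h t ∂μ := by
    rw [integral_congr_ae hke, ← (mp 0).map_eq,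
      integral_map (mp 0).measurable.aemeasurable hkm.aestronglyMeasurable]
  filter_upwards [key, hall] with τ h1 h2
  rw [hint] at h1
  simpa only [h2] using h1

/-- Finite Jensen inequality in law. -/
lemma jensen_finite (N : ℕ) (f : ProbabilityMeasure (Fin N → ℝ) → ℝ)
    (hconv : ConvexInLaw N f)
    (Ω : Type) [MeasurableSpace Ω] (P : Measure Ω) [IsProbabilityMeasure P]
    (Z : ℕ → Ω → (Fin N → ℝ)) (hZ : ∀ i, Integrable (Z i) P)
    (L : ℕ → ProbabilityMeasure (Fin N → ℝ))
    (hL : ∀ i, (L i : Measure (Fin N → ℝ)) = P.map (Z i))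
    (S : ℕ → ProbabilityMeasure (Fin N → ℝ))
    (hS : ∀ n : ℕ, (S n : Measure (Fin N → ℝ)) =
      P.map (fun ω => (n : ℝ)⁻¹ • ∑ i ∈ Finset.range n, Z i ω)) (n : ℕ) :
    (n : ℝ) * f (S n) ≤ ∑ i ∈ Finset.range n, f (L i) := by
  induction n with
  | zero => simp
  | succ n ih =>
    have hn : (0 : ℝ) < (n : ℝ) + 1 := by positivity
    have h := hconv Ω _ P inferInstance
      (fun ω => (n : ℝ)⁻¹ • ∑ i ∈ Finset.range n, Z i ω) (Z n)
      ((integrable_finsetSum _ fun i _ => hZ i).fun_smul _) (hZ n)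
      ((n : ℝ) / (n + 1)) ⟨by positivity, by rw [div_le_one hn]; linarith⟩
      (S n) (L n) (S (n + 1)) (hS n) (hL n) (by
        rw [hS (n + 1)]
        congr 1
        funext ω
        rw [Finset.sum_range_succ, smul_add, smul_smul]
        push_cast
        have e1 : 1 - (n : ℝ) / (n + 1) = ((n : ℝ) + 1)⁻¹ := by field_simp; ring
        rw [e1]
        congr 1
        rcases Nat.eq_zero_or_pos n with h0 | h0
        · subst h0; simp
        · congr 1
          have : (n : ℝ) ≠ 0 := by positivity
          field_simp)
    rw [Finset.sum_range_succ]
    push_cast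
    have h2 := mul_le_mul_of_nonneg_left h hn.le
    have e : ((n : ℝ) + 1) * ((n : ℝ) / (n + 1) * f (S n) + (1 - (n : ℝ) / (n + 1)) * f (L n))
        = n * f (S n) + f (L n) := by field_simp; ring
    linarith

open Filter Topology in
/-- Almost sure convergence implies weak convergence of laws. -/
lemma law_tendsto (N : ℕ)
    (Ω : Type) [MeasurableSpace Ω] (P : Measure Ω) [IsProbabilityMeasure P]
    (Y : ℕ → Ω → (Fin N → ℝ)) (hY : ∀ n, Measurable (Y n))
    (Z : Ω → (Fin N → ℝ)) (hZ : Measurable Z)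
    (hlim : ∀ᵐ ω ∂P, Tendsto (fun n => Y n ω) atTop (𝓝 (Z ω)))
    (S : ℕ → ProbabilityMeasure (Fin N → ℝ))
    (hS : ∀ n : ℕ, (S n : Measure (Fin N → ℝ)) = P.map (Y n))
    (ρ : ProbabilityMeasure (Fin N → ℝ)) (hρ : (ρ : Measure (Fin N → ℝ)) = P.map Z) :
    Tendsto S atTop (𝓝 ρ) := by
  rw [ProbabilityMeasure.tendsto_iff_forall_integral_tendsto]
  intro g
  have e : ∀ n, ∫ x, g x ∂(S n : Measure (Fin N → ℝ)) = ∫ ω, g (Y n ω) ∂P := fun n => by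
    rw [hS, integral_map (hY n).aemeasurable g.continuous.aestronglyMeasurable]
  simp only [e]
  rw [hρ, integral_map hZ.aemeasurable g.continuous.aestronglyMeasurable]
  refine tendsto_integral_of_dominated_convergence (fun _ => ‖g‖)
    (fun n => (g.continuous.measurable.comp (hY n)).aestronglyMeasurable)
    (integrable_const _) (fun n => ae_of_all _ fun ω => g.norm_coe_le_norm _) ?_
  filter_upwards [hlim] with ω hω
  exact (g.continuous.tendsto _).comp hω

open Filter Topology in
/-- Jensen-type inequality in law: if `f` is bounded below, lower
semicontinuous for the topology of weak convergence, and convex in law, and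
`X : [a,b] × Ω → ℝ^N` is jointly measurable and integrable, then
`f (ℒ((b-a)⁻¹ ∫_a^b X_t dt)) ≤ (b-a)⁻¹ ∫_a^b f (ℒ(X_t)) dt`, the right-hand side being
well defined in `(-∞, +∞]` (i.e. either the map `t ↦ f (ℒ(X_t))` fails to be integrable on
`[a,b]`, in which case the right-hand side is `+∞`, or the inequality holds with the real
integral). -/
theorem stmt_10 (N : ℕ) (f : ProbabilityMeasure (Fin N → ℝ) → ℝ)
    (hbdd : BddBelow (Set.range f))
    (hlsc : LowerSemicontinuous f)
    (hconv : ConvexInLaw N f)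
    (Ω : Type) [MeasurableSpace Ω] (P : Measure Ω) [IsProbabilityMeasure P]
    (a b : ℝ) (hab : a < b)
    (X : ℝ → Ω → (Fin N → ℝ))
    (hXmeas : Measurable (Function.uncurry X))
    (hXint : Integrable (fun p : ℝ × Ω => X p.1 p.2)
      ((volume.restrict (Set.Icc a b)).prod P))
    (L : ℝ → ProbabilityMeasure (Fin N → ℝ))
    (hL : ∀ t, (L t : Measure (Fin N → ℝ)) = P.map (X t))
    (ρ : ProbabilityMeasure (Fin N → ℝ))
    (hρ : (ρ : Measure (Fin N → ℝ)) =
      P.map (fun ω => (b - a)⁻¹ • ∫ t in Set.Icc a b, X t ω)) :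
    ¬ IntegrableOn (fun t => f (L t)) (Set.Icc a b) volume ∨
      f ρ ≤ (b - a)⁻¹ * ∫ t in Set.Icc a b, f (L t) := by
  rw [or_iff_not_imp_left, not_not]
  intro hfL
  have hba : 0 < b - a := sub_pos.2 hab
  set ν := volume.restrict (Set.Icc a b) with hν
  set c : ENNReal := ENNReal.ofReal (b - a)⁻¹ with hc
  have hcr : c.toReal = (b - a)⁻¹ := ENNReal.toReal_ofReal (by positivity)
  have hct : c ≠ ⊤ := ENNReal.ofReal_ne_top
  set μ : Measure ℝ := c • ν with hμ
  have : IsProbabilityMeasure μ := ⟨by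
    rw [hμ, Measure.smul_apply, hν, Measure.restrict_apply_univ, Real.volume_Icc, smul_eq_mul, hc,
      ← ENNReal.ofReal_mul (by positivity), inv_mul_cancel₀ hba.ne', ENNReal.ofReal_one]⟩
  have hXt : ∀ t, Measurable (X t) := fun t => hXmeas.of_uncurry_left
  set Q := Measure.infinitePi (fun _ : ℕ => μ) with hQ
  set Z : Ω → (Fin N → ℝ) := fun ω => (b - a)⁻¹ • ∫ t in Set.Icc a b, X t ω with hZ
  have hZm : Measurable Z := by
    have : StronglyMeasurable fun ω => ∫ t, X t ω ∂ν :=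
      StronglyMeasurable.integral_prod_left hXmeas.stronglyMeasurable
    exact this.measurable.fun_const_smul _
  -- convergence of `f`-averages
  have h1 := slln_sample μ (fun t => f (L t)) (hfL.smul_measure hct)
  -- integrability of the samples
  have h2 : ∀ᵐ τ ∂Q, ∀ i, Integrable (X (τ i)) P := by
    have hν2 : ∀ᵐ t ∂ν, Integrable (X t) P := hXint.prod_right_ae
    have hμ2 : ∀ᵐ t ∂μ, Integrable (X t) P := Measure.ae_smul_measure hν2 c
    exact ae_all_iff.2 fun i =>
      (measurePreserving_eval_infinitePi (fun _ : ℕ => μ) i).quasiMeasurePreserving.ae hμ2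
  -- convergence of the sample averages
  have h3 : ∀ᵐ τ ∂Q, ∀ᵐ ω ∂P,
      Tendsto (fun n : ℕ => (n : ℝ)⁻¹ • ∑ i ∈ Finset.range n, X (τ i) ω) atTop (𝓝 (Z ω)) := by
    rw [Measure.ae_ae_comm]
    · filter_upwards [hXint.prod_left_ae] with ω hω
      have := slln_sample μ (fun t => X t ω) (hω.smul_measure hct)
      rw [hμ, integral_smul_measure, hcr] at this
      exact this
    · have hm : ∀ n : ℕ, Measurable fun p : (ℕ → ℝ) × Ω =>
          (n : ℝ)⁻¹ • ∑ i ∈ Finset.range n, X (p.1 i) p.2 := by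
        intro n
        refine Measurable.fun_const_smul (Finset.measurable_fun_sum _ fun i _ => ?_) _
        have hp : Measurable fun p : (ℕ → ℝ) × Ω => (p.1 i, p.2) := by fun_prop
        exact hXmeas.comp hp
      exact measurableSet_tendsto_fun hm (hZm.comp measurable_snd)
  obtain ⟨τ, ⟨h1, h2⟩, h3⟩ := ((h1.and h2).and h3).exists
  have hYm : ∀ n : ℕ, Measurable fun ω => (n : ℝ)⁻¹ • ∑ i ∈ Finset.range n, X (τ i) ω :=
    fun n => (Finset.measurable_fun_sum _ fun i _ => hXt (τ i)).fun_const_smul _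
  let S : ℕ → ProbabilityMeasure (Fin N → ℝ) := fun n =>
    ⟨P.map (fun ω => (n : ℝ)⁻¹ • ∑ i ∈ Finset.range n, X (τ i) ω),
      Measure.isProbabilityMeasure_map (hYm n).aemeasurable⟩
  have hST : Tendsto S atTop (𝓝 ρ) :=
    law_tendsto N Ω P _ hYm Z hZm h3 S (fun n => rfl) ρ hρ
  have hJ := jensen_finite N f hconv Ω P (fun i => X (τ i)) h2 (fun i => L (τ i))
    (fun i => hL _) S (fun n => rfl)
  rw [hμ, integral_smul_measure, hcr, smul_eq_mul] at h1
  refine le_of_forall_lt_imp_le_of_dense fun y hy => ?_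
  refine ge_of_tendsto h1 ?_
  filter_upwards [hST.eventually (hlsc ρ y hy), eventually_gt_atTop 0] with n hn hn0
  have hn0' : (0 : ℝ) < n := by exact_mod_cast hn0
  rw [smul_eq_mul, le_inv_mul_iff₀ hn0']
  exact (mul_le_mul_of_nonneg_left hn.le hn0'.le).trans (hJ n)
end
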